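/- Let (A(k))_{k∈ℤⁿ} be a family of densely defined linear operators in H such that for every k ∈ ℤⁿ the residual spectrum of A(k) is empty (for every λ ∈ ℂ, if λ·id − A(k) is injective then it has dense range). Let λ ∈ ℂ be such that λ·id − A(k) is injective for every k ∈ ℤⁿ. Then λ·id − M_A is injective with dense range, and its inverse (λ·id − M_A)⁻¹ : ran(λ·id − M_A) → ℓ²(ℤⁿ, H) is bounded if and only if there exists B > 0 such that for every k ∈ ℤⁿ the inverse (λ·id − A(k))⁻¹, defined on ran(λ·id − A(k)), is bounded with norm at most B. Consequently the spectrum of M_A decomposes as σ(M_A) = σ_p(M_A) ∪ σ_c(M_A) with σ_p(M_A) = ⋃_k σ_p(A(k)) and σ_c(M_A) = { λ ∈ ℂ : ‖(λ − A(k))⁻¹‖ is not bounded over k ∈ ℤⁿ } ∖ σ_p(M_A). -/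

import Mathlib

open MeasureTheory

noncomputable section

/-- The domain of the generalized multiplication operator associated to a family
`A : ι → (H →ₗ.[ℂ] H)` of (possibly unbounded) operators: all `f ∈ ℓ²(ι, H)` such that
`f k` lies in the domain of `A k` for every `k` and `k ↦ A k (f k)` is again in `ℓ²`. -/
def mulOpDomain {ι H : Type*} [NormedAddCommGroup H] [InnerProductSpace ℂ H]
    (A : ι → (H →ₗ.[ℂ] H)) : Submodule ℂ (lp (fun _ : ι => H) 2) where
  carrier := {f | ∃ h : ∀ k, f k ∈ (A k).domain,
    Memℓp (fun k => A k ⟨f k, h k⟩) 2}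
  add_mem' := by
    rintro f g ⟨hf, hf2⟩ ⟨hg, hg2⟩
    have hfg : ∀ k, (↑(f + g) : ∀ _ : ι, H) k ∈ (A k).domain := by
      intro k; rw [lp.coeFn_add]; exact add_mem (hf k) (hg k)
    refine ⟨hfg, ?_⟩
    have : (fun k => (A k) ⟨(↑(f + g) : ∀ _ : ι, H) k, hfg k⟩)
        = fun k => (A k) ⟨f k, hf k⟩ + (A k) ⟨g k, hg k⟩ := by
      funext k
      rw [← (A k).map_add]
      congr 1
    rw [this]
    exact hf2.add hg2
  zero_mem' := by
    have h0 : ∀ k, (↑(0 : lp (fun _ : ι => H) 2) : ∀ _ : ι, H) k ∈ (A k).domain := by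
      intro k; rw [lp.coeFn_zero]; exact zero_mem _
    refine ⟨h0, ?_⟩
    have : (fun k => (A k) ⟨(↑(0 : lp (fun _ : ι => H) 2) : ∀ _ : ι, H) k, h0 k⟩)
        = fun _ => (0 : H) := by
      funext k
      have : (⟨(↑(0 : lp (fun _ : ι => H) 2) : ∀ _ : ι, H) k, h0 k⟩ : (A k).domain) = 0 := by
        ext; simp [lp.coeFn_zero]
      rw [this, (A k).map_zero]
    rw [this]
    exact zero_memℓp
  smul_mem' := by
    rintro c f ⟨hf, hf2⟩
    have hcf : ∀ k, (↑(c • f) : ∀ _ : ι, H) k ∈ (A k).domain := by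
      intro k; rw [lp.coeFn_smul]; exact Submodule.smul_mem _ c (hf k)
    refine ⟨hcf, ?_⟩
    have : (fun k => (A k) ⟨(↑(c • f) : ∀ _ : ι, H) k, hcf k⟩)
        = fun k => c • (A k) ⟨f k, hf k⟩ := by
      funext k
      rw [← (A k).map_smul]
      congr 1
    rw [this]
    exact hf2.const_smul c
  
/-- The generalized multiplication operator in `ℓ²(ι, H)` associated to a family
`A : ι → (H →ₗ.[ℂ] H)`, acting by `(M_A f) k = A k (f k)`. -/
def mulOp {ι H : Type*} [NormedAddCommGroup H] [InnerProductSpace ℂ H]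
    (A : ι → (H →ₗ.[ℂ] H)) :
    lp (fun _ : ι => H) 2 →ₗ.[ℂ] lp (fun _ : ι => H) 2 where
  domain := mulOpDomain A
  toFun :=
  { toFun := fun f => ⟨fun k => A k ⟨f.1 k, f.2.choose k⟩, f.2.choose_spec⟩
    map_add' := by
      rintro ⟨f, hf⟩ ⟨g, hg⟩
      ext k
      rw [lp.coeFn_add]
      show (A k) _ = (A k) _ + (A k) _
      rw [← (A k).map_add]
      congr 1
    map_smul' := by
      rintro c ⟨f, hf⟩
      ext k
      rw [lp.coeFn_smul]
      show (A k) _ = (c • ((A k) _ : H))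
      rw [← (A k).map_smul]
      congr 1 }

theorem mem_mulOpDomain_iff {ι H : Type*} [NormedAddCommGroup H] [InnerProductSpace ℂ H]
    (A : ι → (H →ₗ.[ℂ] H)) (f : lp (fun _ : ι => H) 2) :
    f ∈ (mulOp A).domain ↔ ∃ h : ∀ k, f k ∈ (A k).domain,
      Memℓp (fun k => A k ⟨f k, h k⟩) 2 := Iff.rfl

theorem mulOp_apply {ι H : Type*} [NormedAddCommGroup H] [InnerProductSpace ℂ H]
    (A : ι → (H →ₗ.[ℂ] H)) (f : (mulOp A).domain) (k : ι)
    (hk : (f : lp (fun _ : ι => H) 2) k ∈ (A k).domain) :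
    (mulOp A f : lp (fun _ : ι => H) 2) k = A k ⟨(f : lp (fun _ : ι => H) 2) k, hk⟩ := rfl

section MulOp

variable {ι H : Type*} [NormedAddCommGroup H] [InnerProductSpace ℂ H]

theorem coord_mem_domain_of_mem_mulOp_domain {A : ι → (H →ₗ.[ℂ] H)} (f : (mulOp A).domain)
    (k : ι) : (f : lp (fun _ : ι => H) 2) k ∈ (A k).domain :=
  ((mem_mulOpDomain_iff A f).1 f.2).choose k

theorem smul_sub_mulOp_apply (A : ι → (H →ₗ.[ℂ] H)) (c : ℂ) (f : (mulOp A).domain) (k : ι) :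
    (c • (f : lp (fun _ : ι => H) 2) - mulOp A f) k =
      c • (f : lp (fun _ : ι => H) 2) k -
        A k ⟨(f : lp (fun _ : ι => H) 2) k, coord_mem_domain_of_mem_mulOp_domain f k⟩ := by
  rw [lp.coeFn_sub, lp.coeFn_smul, Pi.sub_apply, Pi.smul_apply]
  rfl

theorem injective_smul_sub_mulOp {A : ι → (H →ₗ.[ℂ] H)} {c : ℂ}
    (hinj : ∀ k, Function.Injective fun v : (A k).domain => c • (v : H) - A k v) :
    Function.Injective fun f : (mulOp A).domain =>
      c • (f : lp (fun _ : ι => H) 2) - mulOp A f := by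
  intro f g hfg
  ext k
  have hk : (c • (f : lp (fun _ : ι => H) 2) - mulOp A f) k =
      (c • (g : lp (fun _ : ι => H) 2) - mulOp A g) k :=
    congrArg (fun h : lp (fun _ : ι => H) 2 => h k) hfg
  rw [smul_sub_mulOp_apply, smul_sub_mulOp_apply] at hk
  exact congrArg Subtype.val (@hinj k ⟨_, coord_mem_domain_of_mem_mulOp_domain f k⟩
    ⟨_, coord_mem_domain_of_mem_mulOp_domain g k⟩ hk)

theorem norm_le_mul_norm_smul_sub_mulOp {A : ι → (H →ₗ.[ℂ] H)} {c : ℂ} {B : ℝ} (hB : 0 ≤ B)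
    (h : ∀ (k : ι) (v : (A k).domain), ‖(v : H)‖ ≤ B * ‖c • (v : H) - A k v‖)
    (f : (mulOp A).domain) :
    ‖(f : lp (fun _ : ι => H) 2)‖ ≤
      B * ‖c • (f : lp (fun _ : ι => H) 2) - mulOp A f‖ := by
  set g : lp (fun _ : ι => H) 2 := c • (f : lp (fun _ : ι => H) 2) - mulOp A f with hg
  have hle : ‖(f : lp (fun _ : ι => H) 2)‖ ≤ ‖(B : ℂ) • g‖ := by
    refine lp.norm_mono two_ne_zero fun k => ?_
    rw [lp.coeFn_smul, Pi.smul_apply, norm_smul, Complex.norm_of_nonneg hB, hg,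
      smul_sub_mulOp_apply]
    exact h k ⟨_, coord_mem_domain_of_mem_mulOp_domain f k⟩
  rwa [norm_smul, Complex.norm_of_nonneg hB] at hle

variable [DecidableEq ι]

theorem single_apply_mem_domain (A : ι → (H →ₗ.[ℂ] H)) (k : ι) (v : (A k).domain) (j : ι) :
    (lp.single 2 k (v : H) : lp (fun _ : ι => H) 2) j ∈ (A j).domain := by
  rcases eq_or_ne j k with rfl | hj
  · exact (lp.single_apply_self (E := fun _ : ι => H) 2 j (v : H)).symm ▸ v.2
  · exact (lp.single_apply_ne (E := fun _ : ι => H) 2 k (v : H) hj).symm ▸ zero_mem _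

theorem map_single_apply (A : ι → (H →ₗ.[ℂ] H)) (k : ι) (v : (A k).domain) (j : ι) :
    A j ⟨(lp.single 2 k (v : H) : lp (fun _ : ι => H) 2) j, single_apply_mem_domain A k v j⟩ =
      (lp.single 2 k (A k v) : lp (fun _ : ι => H) 2) j := by
  rcases eq_or_ne j k with rfl | hj
  · exact (congrArg (A j) (Subtype.ext (lp.single_apply_self (E := fun _ : ι => H) 2 j _))).trans
      (lp.single_apply_self (E := fun _ : ι => H) 2 j _).symm
  · refine Eq.trans ?_ (lp.single_apply_ne (E := fun _ : ι => H) 2 k _ hj).symm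
    rw [← (A j).map_zero]
    exact congrArg (A j) (Subtype.ext (lp.single_apply_ne (E := fun _ : ι => H) 2 k _ hj))

theorem single_mem_mulOp_domain (A : ι → (H →ₗ.[ℂ] H)) (k : ι) (v : (A k).domain) :
    (lp.single 2 k (v : H) : lp (fun _ : ι => H) 2) ∈ (mulOp A).domain := by
  refine (mem_mulOpDomain_iff A _).2 ⟨single_apply_mem_domain A k v, ?_⟩
  rw [funext (map_single_apply A k v)]
  exact lp.memℓp _

theorem mulOp_single (A : ι → (H →ₗ.[ℂ] H)) (k : ι) (v : (A k).domain) :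
    mulOp A ⟨lp.single 2 k (v : H), single_mem_mulOp_domain A k v⟩ = lp.single 2 k (A k v) :=
  lp.ext (funext (map_single_apply A k v))

theorem smul_sub_mulOp_single (A : ι → (H →ₗ.[ℂ] H)) (c : ℂ) (k : ι) (v : (A k).domain) :
    c • (lp.single 2 k (v : H) : lp (fun _ : ι => H) 2) -
        mulOp A ⟨lp.single 2 k (v : H), single_mem_mulOp_domain A k v⟩ =
      lp.single 2 k (c • (v : H) - A k v) := by
  rw [mulOp_single, lp.single_sub, lp.single_smul]

theorem Submodule.dense_of_forall_single_mem (S : Submodule ℂ (lp (fun _ : ι => H) 2))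
    {D : ι → Set H} (hD : ∀ k, Dense (D k)) (hS : ∀ k, ∀ x ∈ D k, lp.single 2 k x ∈ S) :
    Dense (S : Set (lp (fun _ : ι => H) 2)) := by
  have hsingle : ∀ k x, (lp.single 2 k x : lp (fun _ : ι => H) 2) ∈ S.topologicalClosure :=
    fun k x => map_mem_closure (lp.isometry_single k).continuous (hD k x) (hS k)
  intro f
  exact S.isClosed_topologicalClosure.mem_of_tendsto
    (lp.hasSum_single ENNReal.ofNat_ne_top f)
    (.of_forall fun s => S.topologicalClosure.sum_mem fun k _ => hsingle k (f k))

theorem dense_range_smul_sub_mulOp {A : ι → (H →ₗ.[ℂ] H)} {c : ℂ}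
    (hdense : ∀ k, Dense (Set.range fun v : (A k).domain => c • (v : H) - A k v)) :
    Dense (Set.range fun f : (mulOp A).domain =>
      c • (f : lp (fun _ : ι => H) 2) - mulOp A f) := by
  refine Submodule.dense_of_forall_single_mem
    (LinearMap.range (c • (mulOp A).domain.subtype - (mulOp A).toFun)) hdense ?_
  rintro k _ ⟨v, rfl⟩
  exact ⟨⟨_, single_mem_mulOp_domain A k v⟩, smul_sub_mulOp_single A c k v⟩

theorem norm_le_mul_norm_smul_sub_of_mulOp {A : ι → (H →ₗ.[ℂ] H)} {c : ℂ} {C : ℝ}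
    (h : ∀ f : (mulOp A).domain, ‖(f : lp (fun _ : ι => H) 2)‖ ≤
      C * ‖c • (f : lp (fun _ : ι => H) 2) - mulOp A f‖)
    (k : ι) (v : (A k).domain) : ‖(v : H)‖ ≤ C * ‖c • (v : H) - A k v‖ := by
  have hv := h ⟨_, single_mem_mulOp_domain A k v⟩
  rwa [smul_sub_mulOp_single, lp.norm_single two_pos, lp.norm_single two_pos] at hv

end MulOp

/-- Suppose every `A k` is densely defined with empty residual spectrum, and
let `λ ∈ ℂ` be such that `λ·id − A k` is injective for every `k`. Then `λ·id − M_A` is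
injective with dense range, and its inverse is bounded iff the inverses `(λ·id − A k)⁻¹` are
bounded uniformly in `k`. -/
theorem statement7 (n : ℕ) (hn : 1 ≤ n) {H : Type*} [NormedAddCommGroup H]
    [InnerProductSpace ℂ H] [CompleteSpace H] [TopologicalSpace.SeparableSpace H]
    (A : (Fin n → ℤ) → (H →ₗ.[ℂ] H))
    (hA : ∀ k, Dense ((A k).domain : Set H))
    (hres : ∀ (k : Fin n → ℤ) (mu : ℂ),
      Function.Injective (fun v : (A k).domain => mu • (v : H) - A k v) →
      Dense (Set.range fun v : (A k).domain => mu • (v : H) - A k v))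
    (lam : ℂ)
    (hinj : ∀ k, Function.Injective (fun v : (A k).domain => lam • (v : H) - A k v)) :
    Function.Injective (fun f : (mulOp A).domain =>
      lam • (f : lp (fun _ : Fin n → ℤ => H) 2) - mulOp A f) ∧
    Dense (Set.range fun f : (mulOp A).domain =>
      lam • (f : lp (fun _ : Fin n → ℤ => H) 2) - mulOp A f) ∧
    ((∃ C > (0 : ℝ), ∀ f : (mulOp A).domain,
        ‖(f : lp (fun _ : Fin n → ℤ => H) 2)‖ ≤
          C * ‖lam • (f : lp (fun _ : Fin n → ℤ => H) 2) - mulOp A f‖) ↔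
      ∃ B > (0 : ℝ), ∀ (k : Fin n → ℤ) (v : (A k).domain),
        ‖(v : H)‖ ≤ B * ‖lam • (v : H) - A k v‖) := by
  exact ⟨injective_smul_sub_mulOp hinj,
    dense_range_smul_sub_mulOp fun k => hres k lam (hinj k),
    fun ⟨C, hC, h⟩ => ⟨C, hC, norm_le_mul_norm_smul_sub_of_mulOp h⟩,
    fun ⟨B, hB, h⟩ => ⟨B, hB, norm_le_mul_norm_smul_sub_mulOp hB.le h⟩⟩
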